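/- Let f : ℝ → ℝ be C¹, r, d : ℝ → ℝ continuous with r(y) ≤ r̄ and d(y) ≥ d̲ for all y, where r̄ > 0 and d̲ > 0, and let M : ℝ × ℝ → [0,∞) be continuous. Let u : [0,T] × ℝ → [0,∞) be C¹, vanishing for |y| ≥ R for some fixed R > 0, with (y,z) ↦ M(y,z)u(t,z) and y ↦ (∫M(z,y)dz)u(t,y) integrable for each t, and satisfying ∂_t u + ∂_y( f u ) = ( r(y) − d(y)ρ(t) ) u + ∫ M(y,z)u(t,z)dz − ( ∫ M(z,y)dz ) u, where ρ(t) = ∫_ℝ u(t,y)dy. Then the total population size is bounded: ρ(t) ≤ max( ρ(0), r̄/d̲ ) for all t ∈ [0,T]. -/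

import Mathlib

open MeasureTheory

lemma tpb_conv (R : ℝ) (hR : 0 < R) (g : ℝ → ℝ) (h : ∀ y, R ≤ |y| → g y = 0) :
    ∫ y in (-R)..R, g y = ∫ y, g y := by
  rw [intervalIntegral.integral_of_le (by linarith)]
  apply setIntegral_eq_integral_of_forall_compl_eq_zero
  intro y hy
  apply h
  by_contra hlt
  rw [not_le, abs_lt] at hlt
  exact hy ⟨hlt.1, hlt.2.le⟩

lemma tpb_hasDeriv (u : ℝ → ℝ → ℝ) (hu : ContDiff ℝ 1 (Function.uncurry u)) (t y : ℝ) :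
    HasDerivAt (fun s => u s y) (fderiv ℝ (Function.uncurry u) (t, y) (1, 0)) t := by
  have h1 : HasFDerivAt (Function.uncurry u) (fderiv ℝ (Function.uncurry u) (t, y)) (t, y) :=
    (hu.differentiable (by norm_num) (t, y)).hasFDerivAt
  have h2 : HasDerivAt (fun s : ℝ => (s, y)) ((1 : ℝ), (0 : ℝ)) t :=
    (hasDerivAt_id t).prodMk (hasDerivAt_const t y)
  exact h1.comp_hasDerivAt t h2

lemma tpb_cont (u : ℝ → ℝ → ℝ) (hu : ContDiff ℝ 1 (Function.uncurry u)) :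
    Continuous (fun p : ℝ × ℝ => fderiv ℝ (Function.uncurry u) p (1, 0)) :=
  (hu.continuous_fderiv (by norm_num)).clm_apply continuous_const

lemma tpb_P (u : ℝ → ℝ → ℝ) (hu : ContDiff ℝ 1 (Function.uncurry u)) (R t : ℝ) :
    HasDerivAt (fun s => ∫ y in (-R)..R, u s y)
      (∫ y in (-R)..R, fderiv ℝ (Function.uncurry u) (t, y) (1, 0)) t := by
  have hc := tpb_cont u hu
  have hcomp : IsCompact (Set.Icc (t-1) (t+1) ×ˢ Set.uIcc (-R) R) :=
    isCompact_Icc.prod isCompact_uIcc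
  obtain ⟨C, hC⟩ := hcomp.exists_bound_of_continuousOn hc.continuousOn
  have huc : ∀ s, Continuous (u s) := fun s =>
    hu.continuous.comp (Continuous.prodMk continuous_const continuous_id)
  refine (intervalIntegral.hasDerivAt_integral_of_dominated_loc_of_deriv_le
    (F := u) (F' := fun s y => fderiv ℝ (Function.uncurry u) (s, y) (1, 0))
    (bound := fun _ => C) (s := Set.Icc (t-1) (t+1))
    (Icc_mem_nhds (by linarith) (by linarith)) ?_ ?_ ?_ ?_ ?_ ?_).2
  · exact Filter.Eventually.of_forall fun s => (huc s).aestronglyMeasurable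
  · exact (huc t).intervalIntegrable _ _
  · exact (hc.comp (Continuous.prodMk continuous_const continuous_id)).aestronglyMeasurable
  · exact Filter.Eventually.of_forall fun y hy s hs =>
      hC (s, y) ⟨hs, Set.uIoc_subset_uIcc hy⟩
  · exact intervalIntegrable_const
  · exact Filter.Eventually.of_forall fun y hy s hs => tpb_hasDeriv u hu s y

/-- For a C¹, compactly supported (in phenotype) nonnegative solution of the
advection–selection–mutation equation with `r(y) ≤ r̄` and `d(y) ≥ d̲` (`r̄, d̲ > 0`),
the total population size `ρ(t) = ∫ u(t,y) dy` remains bounded: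
`ρ(t) ≤ max(ρ(0), r̄/d̲)` for all `t ∈ [0,T]`. -/
theorem total_population_bounded
    (T rbar dlow : ℝ) (f r d : ℝ → ℝ) (M : ℝ × ℝ → ℝ) (u : ℝ → ℝ → ℝ) (R : ℝ)
    (hf : ContDiff ℝ 1 f)
    (hr : Continuous r)
    (hd : Continuous d)
    (hrbar : 0 < rbar)
    (hdlow : 0 < dlow)
    (hr_le : ∀ y, r y ≤ rbar)
    (hd_ge : ∀ y, dlow ≤ d y)
    (hM : Continuous M)
    (hM_nonneg : ∀ p, 0 ≤ M p)
    (hu : ContDiff ℝ 1 (Function.uncurry u))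
    (hu_nonneg : ∀ t ∈ Set.Icc (0:ℝ) T, ∀ y : ℝ, 0 ≤ u t y)
    (hR : 0 < R)
    (hsupp : ∀ t ∈ Set.Icc (0:ℝ) T, ∀ y : ℝ, R ≤ |y| → u t y = 0)
    (hint_gain : ∀ t ∈ Set.Icc (0:ℝ) T,
      Integrable (fun p : ℝ × ℝ => M p * u t p.2))
    (hint_loss : ∀ t ∈ Set.Icc (0:ℝ) T,
      Integrable (fun y => (∫ z, M (z, y)) * u t y))
    (hpde : ∀ t ∈ Set.Icc (0:ℝ) T, ∀ y : ℝ,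
      deriv (fun s => u s y) t + deriv (fun x => f x * u t x) y =
        (r y - d y * (∫ z, u t z)) * u t y
          + (∫ z, M (y, z) * u t z) - (∫ z, M (z, y)) * u t y) :
    ∀ t ∈ Set.Icc (0:ℝ) T,
      (∫ y, u t y) ≤ max (∫ y, u 0 y) (rbar / dlow) := by
  have hRR : -R ≤ R := by linarith
  have huc : ∀ s, Continuous (u s) := fun s =>
    hu.continuous.comp (Continuous.prodMk continuous_const continuous_id)
  have hcv : ∀ t ∈ Set.Icc (0:ℝ) T, ∫ y in (-R)..R, u t y = ∫ y, u t y := fun t ht =>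
    tpb_conv R hR _ (hsupp t ht)
  have key : ∀ t ∈ Set.Icc (0:ℝ) T,
      (∫ y in (-R)..R, fderiv ℝ (Function.uncurry u) (t, y) (1, 0)) ≤
        (rbar - dlow * ∫ y in (-R)..R, u t y) * ∫ y in (-R)..R, u t y := by
    intro t ht
    have hρ := hcv t ht
    set ρ := ∫ y in (-R)..R, u t y with hρdef
    have hρ0 : 0 ≤ ρ := by rw [hρ]; exact integral_nonneg (hu_nonneg t ht)
    have hfu : ContDiff ℝ 1 (fun x => f x * u t x) :=
      hf.mul (hu.comp (contDiff_const.prodMk contDiff_id))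
    have hfuc : Continuous (deriv (fun x => f x * u t x)) := hfu.continuous_deriv (by norm_num)
    have hadv : ∫ y in (-R)..R, deriv (fun x => f x * u t x) y = 0 := by
      rw [intervalIntegral.integral_deriv_eq_sub
        (fun x _ => hfu.differentiable (by norm_num) x) (hfuc.intervalIntegrable _ _),
        hsupp t ht R (le_abs_self R), hsupp t ht (-R) (by rw [abs_neg]; exact le_abs_self R)]
      ring
    have hig : Integrable (fun y => ∫ z, M (y, z) * u t z) :=
      (hint_gain t ht).integral_prod_left
    have hg0 : ∀ y, 0 ≤ ∫ z, M (y, z) * u t z := fun y =>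
      integral_nonneg fun z => mul_nonneg (hM_nonneg _) (hu_nonneg t ht z)
    have hswap : ∫ y, ∫ z, M (y, z) * u t z = ∫ y, (∫ z, M (z, y)) * u t y := by
      have := integral_integral_swap (f := fun y z => M (y, z) * u t z) (hint_gain t ht)
      rw [this]
      congr 1
      ext y
      rw [integral_mul_const]
    have hgl : ∫ y in (-R)..R, (∫ z, M (y, z) * u t z) ≤
        ∫ y in (-R)..R, (∫ z, M (z, y)) * u t y := by
      rw [tpb_conv R hR (fun y => (∫ z, M (z, y)) * u t y)
        (fun y hy => by simp [hsupp t ht y hy]), ← hswap,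
        intervalIntegral.integral_of_le hRR]
      exact setIntegral_le_integral hig (Filter.Eventually.of_forall hg0)
    have hct : Continuous (fun y => fderiv ℝ (Function.uncurry u) (t, y) (1, 0)) :=
      (tpb_cont u hu).comp (Continuous.prodMk continuous_const continuous_id)
    have hcu := huc t
    have i1 := (hfuc.intervalIntegrable (-R) R : IntervalIntegrable _ volume _ _)
    have i2 : IntervalIntegrable (fun y => (rbar - dlow * ρ) * u t y) volume (-R) R :=
      (continuous_const.mul hcu).intervalIntegrable _ _
    have i3 := hig.intervalIntegrable (a := -R) (b := R)
    have i4 := (hint_loss t ht).intervalIntegrable (a := -R) (b := R)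
    have hle : (∫ y in (-R)..R, fderiv ℝ (Function.uncurry u) (t, y) (1, 0)) ≤
        ∫ y in (-R)..R, ((((rbar - dlow * ρ) * u t y + (∫ z, M (y, z) * u t z))
          - (∫ z, M (z, y)) * u t y) - deriv (fun x => f x * u t x) y) := by
      apply intervalIntegral.integral_mono_on hRR (hct.intervalIntegrable _ _)
        (((i2.add i3).sub i4).sub i1)
      intro y _
      have h := hpde t ht y
      rw [(tpb_hasDeriv u hu t y).deriv, ← hρ] at h
      have h2 : (r y - d y * ρ) * u t y ≤ (rbar - dlow * ρ) * u t y := by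
        apply mul_le_mul_of_nonneg_right _ (hu_nonneg t ht y)
        have := mul_le_mul_of_nonneg_right (hd_ge y) hρ0
        linarith [hr_le y]
      linarith
    rw [intervalIntegral.integral_sub ((i2.add i3).sub i4) i1,
      intervalIntegral.integral_sub (i2.add i3) i4, intervalIntegral.integral_add i2 i3,
      intervalIntegral.integral_const_mul, hadv, ← hρdef] at hle
    linarith
  intro t ht
  have h0 : (0:ℝ) ∈ Set.Icc (0:ℝ) T := ⟨le_rfl, ht.1.trans ht.2⟩
  rw [← hcv t ht, ← hcv 0 h0]
  set K := max (∫ y in (-R)..R, u 0 y) (rbar / dlow) with hK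
  have hmain : ∀ ε > 0, (∫ y in (-R)..R, u t y) ≤ K + ε * t := by
    intro ε hε
    refine image_le_of_deriv_right_lt_deriv_boundary (a := 0) (b := T)
      (f := fun s => ∫ y in (-R)..R, u s y) (B := fun s => K + ε * s) (B' := fun _ => ε)
      (fun s _ => (tpb_P u hu R s).continuousAt.continuousWithinAt)
      (fun s _ => (tpb_P u hu R s).hasDerivWithinAt) ?_ ?_ ?_ ht
    · simp [hK]
    · intro s
      simpa using ((hasDerivAt_id s).const_mul ε).const_add K
    · intro s hs heq
      have hs' : s ∈ Set.Icc (0:ℝ) T := ⟨hs.1, hs.2.le⟩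
      have hk := key s hs'
      have heq' : (∫ y in (-R)..R, u s y) = K + ε * s := heq
      have hKr : rbar / dlow ≤ K := le_max_right _ _
      have hge : rbar / dlow ≤ ∫ y in (-R)..R, u s y := by
        rw [heq']; linarith [mul_nonneg hε.le hs.1]
      have hpos : 0 ≤ ∫ y in (-R)..R, u s y := (div_pos hrbar hdlow).le.trans hge
      rw [div_le_iff₀ hdlow] at hge
      have : (rbar - dlow * ∫ y in (-R)..R, u s y) * ∫ y in (-R)..R, u s y ≤ 0 :=
        mul_nonpos_of_nonpos_of_nonneg (by linarith) hpos
      exact (hk.trans this).trans_lt hε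
  apply le_of_forall_pos_le_add
  intro ε hε
  have ht1 : 0 < t + 1 := by linarith [ht.1]
  refine (hmain (ε / (t + 1)) (div_pos hε ht1)).trans ?_
  have : ε / (t + 1) * t ≤ ε := by
    rw [div_mul_eq_mul_div, div_le_iff₀ ht1]
    nlinarith
  linarith
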